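/- arXiv:1403.5371 — 8 statements merged into one kernel-verified Lean document; each statement's English description precedes it below -/
import Mathlib

section
/- Let G be a finite bipartite multigraph with vertex parts X and Y, and let α : X → ℝ and β : Y → ℝ be functions taking nonnegative values. Then there exists an (α,β)-hyperflow of G if and only if α(A) ≥ 0 for every subset A ⊆ X, with equality for A = X. -/
open Finset

/-- `φ` is an `(α,β)`-hyperflow of the finite bipartite multigraph with vertex parts `X`, `Y`,
edge set `E`, and endpoint maps `a : E → X` and `b : E → Y`. -/
def IsHyperflow {X Y E : Type*} [Fintype E] [DecidableEq X] [DecidableEq Y]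
    (a : E → X) (b : E → Y) (α : X → ℝ) (β : Y → ℝ) (φ : E → ℝ) : Prop :=
  (∀ e, 0 ≤ φ e) ∧
  (∀ x, ∑ e ∈ univ.filter (fun e => a e = x), φ e = α x) ∧
  (∀ y, ∑ e ∈ univ.filter (fun e => b e = y), φ e = β y)

/-- `Y_A`: the set of vertices of `Y` all of whose incident edges have their `X`-endpoint
in `A`. -/
def innerDark {X Y E : Type*} [Fintype Y] [Fintype E] [DecidableEq X] [DecidableEq Y]
    (a : E → X) (b : E → Y) (A : Finset X) : Finset Y :=
  univ.filter (fun y => ∀ e, b e = y → a e ∈ A)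

/-- `α(A) := Σ_{x∈A} α x − Σ_{y ∈ Y_A} β y`. -/
def chargeOf {X Y E : Type*} [Fintype Y] [Fintype E] [DecidableEq X] [DecidableEq Y]
    (a : E → X) (b : E → Y) (α : X → ℝ) (β : Y → ℝ) (A : Finset X) : ℝ :=
  ∑ x ∈ A, α x - ∑ y ∈ innerDark a b A, β y

open MeasureTheory in
/-- Layer-cake formula for a single value of a bounded interval. -/
theorem integral_ite_lt {c v M : ℝ} (hcv : c ≤ v) (hvM : v ≤ M) :
    IntervalIntegrable (fun t => if t < v then (1 : ℝ) else 0) volume c M ∧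
      ∫ t in c..M, (if t < v then (1 : ℝ) else 0) = v - c := by
  have h1 : Set.EqOn (fun _ => (1 : ℝ)) (fun t => if t < v then (1 : ℝ) else 0)
      (Set.Ioo c v) := fun t ht => by simp [ht.2]
  have h2 : Set.EqOn (fun _ => (0 : ℝ)) (fun t => if t < v then (1 : ℝ) else 0)
      (Set.Ioo v M) := fun t ht => by simp [ht.1.le]
  have i1 : IntervalIntegrable (fun t => if t < v then (1 : ℝ) else 0) volume c v :=
    (intervalIntegrable_const (c := (1 : ℝ))).congr_uIoo (by rwa [Set.uIoo_of_le hcv])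
  have i2 : IntervalIntegrable (fun t => if t < v then (1 : ℝ) else 0) volume v M :=
    (intervalIntegrable_const (c := (0 : ℝ))).congr_uIoo (by rwa [Set.uIoo_of_le hvM])
  refine ⟨i1.trans i2, ?_⟩
  rw [← intervalIntegral.integral_add_adjacent_intervals i1 i2,
    ← intervalIntegral.integral_congr_uIoo (a := c) (b := v) (f := fun _ => (1 : ℝ))
      (by rwa [Set.uIoo_of_le hcv]),
    ← intervalIntegral.integral_congr_uIoo (a := v) (b := M) (f := fun _ => (0 : ℝ))
      (by rwa [Set.uIoo_of_le hvM])]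
  simp

section Hyperflow

variable {X Y E : Type*} [Fintype X] [Fintype Y] [Fintype E] [DecidableEq X] [DecidableEq Y]
  {a : E → X} {b : E → Y} {α : X → ℝ} {β : Y → ℝ}

theorem innerDark_univ : innerDark a b univ = univ := by
  simp [innerDark]

omit [Fintype X] in
theorem IsHyperflow.chargeOf_nonneg {φ : E → ℝ} (h : IsHyperflow a b α β φ) (A : Finset X) :
    0 ≤ chargeOf a b α β A := by
  obtain ⟨h0, hX, hY⟩ := h
  simp only [chargeOf, ← hX, ← hY, sum_filter]
  rw [sum_comm, sum_comm (s := innerDark a b A), ← sum_sub_distrib]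
  refine sum_nonneg fun e _ => ?_
  simp only [sum_ite_eq, innerDark, mem_filter, mem_univ, true_and]
  have := h0 e
  split_ifs with h1 h2 h2
  · simp
  · simpa
  · exact absurd (h2 e rfl) h1
  · simp

theorem IsHyperflow.chargeOf_univ {φ : E → ℝ} (h : IsHyperflow a b α β φ) :
    chargeOf a b α β univ = 0 := by
  obtain ⟨-, hX, hY⟩ := h
  simp only [chargeOf, innerDark_univ, ← hX, ← hY, sum_fiberwise, sub_self]

/-- At each vertex `y`, all of `β y` can be put on an edge minimising `f ∘ a`. -/
theorem exists_greedy_distribution [DecidableEq E] (hβ : ∀ y, 0 ≤ β y)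
    (hiso : ∀ y, (∀ e, b e ≠ y) → β y = 0) (f : X → ℝ) {c M : ℝ} (hcM : c ≤ M)
    (hf : ∀ x, f x ∈ Set.Icc c M) (y : Y) :
    ∃ (ψ : E → ℝ) (m : ℝ), m ∈ Set.Icc c M ∧ (∀ e, 0 ≤ ψ e) ∧
      ∑ e ∈ univ.filter (fun e => b e = y), ψ e = β y ∧
      ∑ e ∈ univ.filter (fun e => b e = y), f (a e) * ψ e = m * β y ∧
      ∀ t, (if y ∈ innerDark a b (univ.filter (fun x => t < f x)) then β y else 0) =
        (if t < m then 1 else 0) * β y := by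
  by_cases h : ∀ e, b e ≠ y
  · exact ⟨0, c, ⟨le_rfl, hcM⟩, by simp, by simp [hiso y h], by simp [hiso y h],
      by simp [hiso y h]⟩
  push Not at h
  obtain ⟨e₀, he₀⟩ := h
  obtain ⟨e, he, hmin⟩ := exists_min_image (univ.filter (fun e => b e = y))
    (fun e => f (a e)) ⟨e₀, by simpa⟩
  simp only [mem_filter, mem_univ, true_and] at he hmin
  refine ⟨Pi.single e (β y), f (a e), hf _, fun e' => ?_, ?_, ?_, fun t => ?_⟩
  · by_cases h : e' = e
    · subst h; simpa using hβ y
    · simp [h]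
  · simp [Pi.single_apply, he]
  · simp [Pi.single_apply, he]
  · have : y ∈ innerDark a b (univ.filter (fun x => t < f x)) ↔ t < f (a e) := by
      simp only [innerDark, mem_filter, mem_univ, true_and]
      exact ⟨fun h => h e he, fun h e' he' => h.trans_le (hmin e' he')⟩
    simp [this]

/-- Every linear functional is minimised over the distributions of `β` at a value
not exceeding its value at `α`. -/
theorem exists_distribution_le (hβ : ∀ y, 0 ≤ β y)
    (hA : ∀ A : Finset X, 0 ≤ chargeOf a b α β A) (hX : chargeOf a b α β univ = 0)
    (f : X → ℝ) :
    ∃ φ : E → ℝ, (∀ e, 0 ≤ φ e) ∧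
      (∀ y, ∑ e ∈ univ.filter (fun e => b e = y), φ e = β y) ∧
      ∑ e, f (a e) * φ e ≤ ∑ x, f x * α x := by
  classical
  have hiso : ∀ y, (∀ e, b e ≠ y) → β y = 0 := by
    intro y hy
    have h := hA ∅
    simp only [chargeOf, sum_empty, zero_sub, Left.nonneg_neg_iff] at h
    have hy' : y ∈ innerDark a b ∅ := by simpa [innerDark] using hy
    exact le_antisymm ((single_le_sum (fun y _ => hβ y) hy').trans h) (hβ y)
  set M := ∑ x, |f x| with hM
  have hM0 : 0 ≤ M := sum_nonneg fun x _ => abs_nonneg _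
  have hf : ∀ x, f x ∈ Set.Icc (-M) M := fun x =>
    abs_le.1 (single_le_sum (f := fun x => |f x|) (fun x _ => abs_nonneg _) (mem_univ x))
  have hcM : -M ≤ M := by linarith
  choose ψ m hm hψ0 hψ hψf hlevel using
    exists_greedy_distribution (a := a) (b := b) hβ hiso f hcM hf
  have hfib : ∀ (g : E → ℝ) (y : Y), ∑ e ∈ univ.filter (fun e => b e = y), g e * ψ (b e) e =
      ∑ e ∈ univ.filter (fun e => b e = y), g e * ψ y e := fun g y =>
    sum_congr rfl fun e he => by rw [(mem_filter.1 he).2]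
  refine ⟨fun e => ψ (b e) e, fun e => hψ0 _ _, fun y => ?_, ?_⟩
  · simpa [hψ] using hfib 1 y
  have hint : ∀ t : ℝ, chargeOf a b α β (univ.filter (fun x => t < f x)) =
      ∑ x, (if t < f x then 1 else 0) * α x - ∑ y, (if t < m y then 1 else 0) * β y := by
    intro t
    simp only [← hlevel, chargeOf, sum_filter, ite_mul, one_mul, zero_mul, sum_ite_mem,
      univ_inter]
  have hnonneg : 0 ≤ ∫ t in (-M)..M, chargeOf a b α β (univ.filter (fun x => t < f x)) :=
    intervalIntegral.integral_nonneg hcM fun t _ => hA _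
  simp only [hint] at hnonneg
  have hix := fun x => integral_ite_lt (hf x).1 (hf x).2
  have hiy := fun y => integral_ite_lt (hm y).1 (hm y).2
  rw [intervalIntegral.integral_sub
      (by simpa only [Finset.sum_fn] using
        IntervalIntegrable.sum univ fun x _ => (hix x).1.mul_const (α x))
      (by simpa only [Finset.sum_fn] using
        IntervalIntegrable.sum univ fun y _ => (hiy y).1.mul_const (β y)),
    intervalIntegral.integral_finsetSum fun x _ => (hix x).1.mul_const (α x),
    intervalIntegral.integral_finsetSum fun y _ => (hiy y).1.mul_const (β y)] at hnonneg
  simp only [intervalIntegral.integral_mul_const, (hix _).2, (hiy _).2, sub_mul,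
    sum_sub_distrib, ← mul_sum] at hnonneg
  simp only [chargeOf, innerDark_univ] at hX
  rw [sub_eq_zero.1 hX] at hnonneg
  rw [← sum_fiberwise univ b]
  simp only [hfib, hψf]
  linarith

omit [Fintype Y] in
/-- The nonnegative edge weightings distributing `β` form a compact set. -/
theorem isCompact_distributions (b : E → Y) (β : Y → ℝ) :
    IsCompact {φ : E → ℝ | (∀ e, 0 ≤ φ e) ∧
      ∀ y, ∑ e ∈ univ.filter (fun e => b e = y), φ e = β y} := by
  refine (isCompact_Icc (a := (0 : E → ℝ)) (b := fun e => β (b e))).of_isClosed_subset ?_ ?_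
  · simp only [Set.ofPred_and, Set.ofPred_forall]
    refine (isClosed_iInter fun e => isClosed_le continuous_const (continuous_apply e)).inter
      (isClosed_iInter fun y => isClosed_eq ?_ continuous_const)
    fun_prop
  · rintro φ ⟨h0, hY⟩
    refine ⟨h0, fun e => ?_⟩
    change φ e ≤ β (b e)
    rw [← hY (b e)]
    exact single_le_sum (fun e _ => h0 e) (by simp)

omit [Fintype Y] in
theorem convex_distributions (b : E → Y) (β : Y → ℝ) :
    Convex ℝ {φ : E → ℝ | (∀ e, 0 ≤ φ e) ∧
      ∀ y, ∑ e ∈ univ.filter (fun e => b e = y), φ e = β y} := by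
  rintro φ ⟨h0, hY⟩ φ' ⟨h0', hY'⟩ s t hs ht hst
  refine ⟨fun e => ?_, fun y => ?_⟩
  · have := h0 e
    have := h0' e
    simp only [Pi.add_apply, Pi.smul_apply, smul_eq_mul]
    positivity
  · simp only [Pi.add_apply, Pi.smul_apply, smul_eq_mul, sum_add_distrib, ← mul_sum, hY, hY',
      ← add_mul, hst, one_mul]

/-- The linear map sending an edge weighting to the total weights at the vertices of `X`. -/
def rowSum (a : E → X) : (E → ℝ) →ₗ[ℝ] (X → ℝ) where
  toFun φ x := ∑ e ∈ univ.filter (fun e => a e = x), φ e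
  map_add' φ φ' := by ext x; simp [sum_add_distrib]
  map_smul' r φ := by ext x; simp [mul_sum]

theorem exists_isHyperflow (hβ : ∀ y, 0 ≤ β y)
    (hA : ∀ A : Finset X, 0 ≤ chargeOf a b α β A) (hX : chargeOf a b α β univ = 0) :
    ∃ φ : E → ℝ, IsHyperflow a b α β φ := by
  by_contra hno
  have hα : α ∉ rowSum a '' {φ : E → ℝ | (∀ e, 0 ≤ φ e) ∧
      ∀ y, ∑ e ∈ univ.filter (fun e => b e = y), φ e = β y} := by
    rintro ⟨φ, ⟨h0, hY⟩, hφ⟩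
    exact hno ⟨φ, h0, congrFun hφ, hY⟩
  obtain ⟨F, u, hu, hF⟩ := geometric_hahn_banach_point_closed
    ((convex_distributions b β).linear_image (rowSum a))
    ((isCompact_distributions b β).image (rowSum a).continuous_of_finiteDimensional).isClosed hα
  have hFsum : ∀ v, F v = ∑ x, F (Pi.single x 1) * v x := fun v => by
    have hs : ∀ x : X, (fun j => if x = j then (1 : ℝ) else 0) = Pi.single x 1 := fun x => by
      ext j
      simp [Pi.single_apply, eq_comm]
    simpa only [hs, smul_eq_mul, mul_comm, ContinuousLinearMap.coe_coe] using
      (F : (X → ℝ) →ₗ[ℝ] ℝ).pi_apply_eq_sum_univ v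
  obtain ⟨φ, h0, hY, hle⟩ := exists_distribution_le hβ hA hX fun x => F (Pi.single x 1)
  have h := hF _ ⟨φ, ⟨h0, hY⟩, rfl⟩
  rw [hFsum] at h hu
  have hrow : ∑ x, F (Pi.single x 1) * rowSum a φ x = ∑ e, F (Pi.single (a e) 1) * φ e := by
    rw [← sum_fiberwise univ a]
    refine sum_congr rfl fun x _ => ?_
    simp only [rowSum, LinearMap.coe_mk, AddHom.coe_mk, mul_sum]
    exact sum_congr rfl fun e he => by rw [(mem_filter.1 he).2]
  linarith

end Hyperflow

/-- There exists an `(α,β)`-hyperflow of `G` if and only if `α(A) ≥ 0` for every subset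
`A ⊆ X`, with equality for `A = X`. -/
theorem exists_hyperflow_iff {X Y E : Type*} [Fintype X] [Fintype Y] [Fintype E]
    [DecidableEq X] [DecidableEq Y]
    (a : E → X) (b : E → Y) (α : X → ℝ) (β : Y → ℝ)
    (hα : ∀ x, 0 ≤ α x) (hβ : ∀ y, 0 ≤ β y) :
    (∃ φ : E → ℝ, IsHyperflow a b α β φ) ↔
      ((∀ A : Finset X, 0 ≤ chargeOf a b α β A) ∧ chargeOf a b α β univ = 0) := by
  exact ⟨fun ⟨_, h⟩ => ⟨h.chargeOf_nonneg, h.chargeOf_univ⟩,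
    fun h => exists_isHyperflow hβ h.1 h.2⟩
end

section
/- Let φ be an (α,β)-hyperflow of a finite bipartite multigraph G and let x₀ ∈ X. Then φ is accessible from x₀ if and only if α(A) > 0 for every nonempty subset A ⊆ X with x₀ ∉ A. -/
open Finset

/-- The step relation on `X` associated to a hyperflow `φ`: `x` steps to `x'` if there is a
vertex `y ∈ Y`, an edge `e` from `x` to `y`, and an edge `e'` from `x'` to `y` carrying
positive flow. -/
def Step {X Y E : Type*} (a : E → X) (b : E → Y) (φ : E → ℝ) (x x' : X) : Prop :=
  ∃ e e' : E, a e = x ∧ a e' = x' ∧ b e = b e' ∧ 0 < φ e'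

/-- The hyperflow `φ` is accessible from `x₀` if every `x ∈ X` can be reached from `x₀`
by a `φ`-positive directed path. -/
def Accessible {X Y E : Type*} (a : E → X) (b : E → Y) (φ : E → ℝ) (x₀ : X) : Prop :=
  ∀ x : X, Relation.ReflTransGen (Step a b φ) x₀ x

/-- The charge of `A` is the total flow through the edges that join `A` to a vertex of `Y`
having a neighbour outside `A`. -/
theorem IsHyperflow.chargeOf_eq_sum {X Y E : Type*} [Fintype Y] [Fintype E]
    [DecidableEq X] [DecidableEq Y]
    {a : E → X} {b : E → Y} {α : X → ℝ} {β : Y → ℝ} {φ : E → ℝ}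
    (hφ : IsHyperflow a b α β φ) (A : Finset X) :
    chargeOf a b α β A =
      ∑ e ∈ univ.filter (fun e => a e ∈ A ∧ b e ∉ innerDark a b A), φ e := by
  obtain ⟨-, hα, hβ⟩ := hφ
  have hA : ∑ x ∈ A, α x = ∑ e ∈ univ.filter (fun e => a e ∈ A), φ e := by
    simp only [← hα, sum_filter]
    rw [sum_comm]
    simp
  have hB : ∑ y ∈ innerDark a b A, β y =
      ∑ e ∈ univ.filter (fun e => b e ∈ innerDark a b A), φ e := by
    simp only [← hβ, sum_filter]
    rw [sum_comm]
    simp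
  have hdark : ∀ e, b e ∈ innerDark a b A → a e ∈ A := fun e he =>
    (mem_filter.1 he).2 e rfl
  rw [chargeOf, hA, hB, sum_filter, sum_filter, sum_filter, ← sum_sub_distrib]
  refine sum_congr rfl fun e _ => ?_
  by_cases h : b e ∈ innerDark a b A
  · simp [h, hdark e h]
  · simp [h]

/-- The charge of `A` is positive exactly when some step enters `A` from outside. -/
theorem IsHyperflow.chargeOf_pos_iff {X Y E : Type*} [Fintype Y] [Fintype E]
    [DecidableEq X] [DecidableEq Y]
    {a : E → X} {b : E → Y} {α : X → ℝ} {β : Y → ℝ} {φ : E → ℝ}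
    (hφ : IsHyperflow a b α β φ) (A : Finset X) :
    0 < chargeOf a b α β A ↔ ∃ x, x ∉ A ∧ ∃ x' ∈ A, Step a b φ x x' := by
  rw [hφ.chargeOf_eq_sum, sum_pos_iff_of_nonneg fun e _ => hφ.1 e]
  simp only [mem_filter, mem_univ, true_and, innerDark, not_forall]
  constructor
  · rintro ⟨e', ⟨hA, e, hb, he⟩, hpos⟩
    exact ⟨a e, he, a e', hA, e, e', rfl, rfl, hb, hpos⟩
  · rintro ⟨_, he, _, hA, e, e', rfl, rfl, hb, hpos⟩
    exact ⟨e', ⟨hA, e, hb, he⟩, hpos⟩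

/-- Every vertex is reachable from `x₀` if and only if every nonempty finite set avoiding `x₀`
is entered by some step. -/
theorem forall_reflTransGen_iff_forall_finset {X : Type*} [Fintype X] (r : X → X → Prop)
    (x₀ : X) :
    (∀ x, Relation.ReflTransGen r x₀ x) ↔
      ∀ A : Finset X, A.Nonempty → x₀ ∉ A → ∃ x, x ∉ A ∧ ∃ x' ∈ A, r x x' := by
  classical
  constructor
  · rintro h A ⟨z, hz⟩ h₀
    by_contra! hA
    have avoids : ∀ x, Relation.ReflTransGen r x₀ x → x ∉ A := by
      intro x hx
      induction hx with
      | refl => exact h₀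
      | tail _ hstep ih => exact fun hc => hA _ ih _ hc hstep
    exact avoids z (h z) hz
  · intro h z
    by_contra hz
    obtain ⟨x, hx, x', hx', hstep⟩ :=
      h (univ.filter fun x => ¬ Relation.ReflTransGen r x₀ x) ⟨z, by simpa using hz⟩
        (by simpa using Relation.ReflTransGen.refl)
    simp only [mem_filter, mem_univ, true_and, not_not] at hx hx'
    exact hx' (hx.tail hstep)


/-- An `(α,β)`-hyperflow `φ` is accessible from `x₀ ∈ X` if and only if `α(A) > 0` for every
nonempty subset `A ⊆ X` not containing `x₀`. -/
theorem hyperflow_accessible_iff {X Y E : Type*} [Fintype X] [Fintype Y] [Fintype E]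
    [DecidableEq X] [DecidableEq Y]
    (a : E → X) (b : E → Y) (α : X → ℝ) (β : Y → ℝ) (φ : E → ℝ)
    (hφ : IsHyperflow a b α β φ) (x₀ : X) :
    Accessible a b φ x₀ ↔
      ∀ A : Finset X, A.Nonempty → x₀ ∉ A → 0 < chargeOf a b α β A := by
  rw [Accessible, forall_reflTransGen_iff_forall_finset]
  simp only [hφ.chargeOf_pos_iff]
end

section
/- Let φ be an (α,β)-hyperflow of a finite bipartite multigraph G. Then for every subset A ⊆ X, α(A) equals the sum of φ(e) over all edges e with a(e) ∈ A and b(e) ∉ Y_A. In particular α(A) ≥ 0, and α(A) = 0 if and only if every edge e with a(e) ∈ A and b(e) ∉ Y_A satisfies φ(e) = 0. -/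
open Finset

/-- For an `(α,β)`-hyperflow `φ` and any `A ⊆ X`, the quantity `α(A)` equals the sum of
`φ(e)` over edges `e` with `a(e) ∈ A` and `b(e) ∉ Y_A`; in particular `α(A) ≥ 0`, and
`α(A) = 0` iff all such edges carry zero flow. -/
theorem chargeOf_eq_boundary_flow {X Y E : Type*} [Fintype X] [Fintype Y] [Fintype E]
    [DecidableEq X] [DecidableEq Y]
    (a : E → X) (b : E → Y) (α : X → ℝ) (β : Y → ℝ) (φ : E → ℝ)
    (hφ : IsHyperflow a b α β φ) :
    ∀ A : Finset X,
      chargeOf a b α β A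
          = ∑ e ∈ univ.filter (fun e => a e ∈ A ∧ b e ∉ innerDark a b A), φ e ∧
      0 ≤ chargeOf a b α β A ∧
      (chargeOf a b α β A = 0 ↔
        ∀ e : E, a e ∈ A → b e ∉ innerDark a b A → φ e = 0) := by
  intro A
  obtain ⟨hnonneg, hα, hβ⟩ := hφ
  have hcharge : chargeOf a b α β A
      = ∑ e ∈ univ.filter (fun e => a e ∈ A ∧ b e ∉ innerDark a b A), φ e := by
    have hdark : univ.filter (fun e => a e ∈ A ∧ b e ∈ innerDark a b A)
        = univ.filter (fun e => b e ∈ innerDark a b A) :=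
      filter_congr fun e _ =>
        and_iff_right_of_imp fun he => (mem_filter.mp he).2 e rfl
    rw [chargeOf, ← sum_congr rfl fun x _ => hα x, ← sum_congr rfl fun y _ => hβ y,
      sum_fiberwise_eq_sum_filter, sum_fiberwise_eq_sum_filter, sub_eq_iff_eq_add', ← hdark,
      ← filter_filter, ← filter_filter, sum_filter_add_sum_filter_not]
  refine ⟨hcharge, ?_, ?_⟩
  · rw [hcharge]
    exact sum_nonneg fun e _ => hnonneg e
  · rw [hcharge, sum_eq_zero_iff_of_nonneg fun e _ => hnonneg e]
    simp only [mem_filter, mem_univ, true_and, and_imp]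
end

section
/- If φ and ψ are two distinct (α,β)-hyperflows of a finite bipartite multigraph G, then there is an alternating simple cycle along which they differ: there exist n ≥ 1, injective maps x : Fin n → X and y : Fin n → Y, and maps p, q : Fin n → E such that for every i ∈ Fin n one has a(p i) = x i, b(p i) = y i, a(q i) = x (i+1 mod n), b(q i) = y i, and moreover φ(p i) < ψ(p i) and φ(q i) > ψ(q i). -/
open Finset

/-- If two functions have the same sum over `s` and `f` is below `g` somewhere on `s`, then it is
above `g` somewhere on `s`. -/
theorem Finset.exists_gt_of_sum_eq_of_lt {ι : Type*} {s : Finset ι} {f g : ι → ℝ}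
    (h : ∑ i ∈ s, f i = ∑ i ∈ s, g i) {i : ι} (hi : i ∈ s) (hlt : f i < g i) :
    ∃ j ∈ s, g j < f j := by
  by_contra! hle
  exact (Finset.sum_lt_sum hle ⟨i, hi, hlt⟩).ne h

/-- A self-map of a finite type has a periodic point on every forward orbit. -/
theorem Function.exists_iterate_mem_periodicPts {V : Type*} [Finite V] (f : V → V) (v : V) :
    ∃ m : ℕ, f^[m] v ∈ Function.periodicPts f := by
  obtain ⟨i, j, hij, h⟩ := Finite.exists_ne_map_eq_of_infinite fun m : ℕ => f^[m] v
  wlog hlt : i < j generalizing i j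
  · exact this j i hij.symm h.symm (lt_of_le_of_ne (not_lt.mp hlt) hij.symm)
  refine ⟨i, j - i, Nat.sub_pos_of_lt hlt, ?_⟩
  change f^[j - i] (f^[i] v) = f^[i] v
  rw [← Function.iterate_add_apply, Nat.sub_add_cancel hlt.le]
  exact h.symm

/-- If `φ` and `ψ` are two distinct `(α,β)`-hyperflows, then there is an alternating simple
cycle along which they differ: injective `x : Fin n → X`, `y : Fin n → Y` (with `n ≥ 1`),
and edges `p i : x i → y i`, `q i : x (i+1 mod n) → y i` with `φ (p i) < ψ (p i)` and
`φ (q i) > ψ (q i)` for all `i`. -/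
theorem hyperflows_differ_along_cycle {X Y E : Type*} [Fintype X] [Fintype Y] [Fintype E]
    [DecidableEq X] [DecidableEq Y]
    (a : E → X) (b : E → Y) (α : X → ℝ) (β : Y → ℝ) (φ ψ : E → ℝ)
    (hφ : IsHyperflow a b α β φ) (hψ : IsHyperflow a b α β ψ) (hne : φ ≠ ψ) :
    ∃ (n : ℕ) (x : Fin (n + 1) → X) (y : Fin (n + 1) → Y) (p q : Fin (n + 1) → E),
      Function.Injective x ∧ Function.Injective y ∧
      ∀ i : Fin (n + 1),
        a (p i) = x i ∧ b (p i) = y i ∧ a (q i) = x (i + 1) ∧ b (q i) = y i ∧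
        φ (p i) < ψ (p i) ∧ ψ (q i) < φ (q i) := by
  obtain ⟨-, hφX, hφY⟩ := hφ
  obtain ⟨-, hψX, hψY⟩ := hψ
  have hX (e : E) (he : ψ e < φ e) : ∃ e', a e' = a e ∧ φ e' < ψ e' := by
    obtain ⟨e', h, hlt⟩ := Finset.exists_gt_of_sum_eq_of_lt
      ((hψX (a e)).trans (hφX (a e)).symm) (by simp) he
    exact ⟨e', by simpa using h, hlt⟩
  have hY (e : E) (he : φ e < ψ e) : ∃ e', b e' = b e ∧ ψ e' < φ e' := by
    obtain ⟨e', h, hlt⟩ := Finset.exists_gt_of_sum_eq_of_lt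
      ((hφY (b e)).trans (hψY (b e)).symm) (by simp) he
    exact ⟨e', by simpa using h, hlt⟩
  obtain ⟨e₀, he₀⟩ : ∃ e, φ e < ψ e := by
    obtain ⟨e, he⟩ := Function.ne_iff.mp hne
    obtain h | h := lt_or_gt_of_ne he
    · exact ⟨e, h⟩
    · obtain ⟨e₁, -, h₁⟩ := hX e h
      exact ⟨e₁, h₁⟩
  -- Following a chosen increasing edge out of `x` and then a chosen decreasing edge out of its
  -- other end gives a self-map of the vertices of `X` that meet an increasing edge.
  let S := {x : X // ∃ e, a e = x ∧ φ e < ψ e}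
  let T := {y : Y // ∃ e, b e = y ∧ ψ e < φ e}
  choose t hta ht using fun x : S => x.2
  choose s hsb hs using fun y : T => y.2
  let g : S → T := fun x => ⟨b (t x), hY _ (ht x)⟩
  let k : T → S := fun y => ⟨a (s y), hX _ (hs y)⟩
  let f : S → S := fun x => k (g x)
  obtain ⟨m, hm⟩ := Function.exists_iterate_mem_periodicPts f ⟨a e₀, e₀, rfl, he₀⟩
  set v := f^[m] ⟨a e₀, e₀, rfl, he₀⟩
  obtain ⟨n, hn⟩ := Nat.exists_eq_succ_of_ne_zero
    (Function.minimalPeriod_pos_of_mem_periodicPts hm).ne'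
  let w : Fin (n + 1) → S := fun i => f^[i] v
  have hw : Function.Injective w := fun i j hij =>
    Fin.ext (Function.iterate_injOn_Iio_minimalPeriod (f := f) (x := v)
      (by simpa [hn] using i.2) (by simpa [hn] using j.2) hij)
  have hstep (i : Fin (n + 1)) : w (i + 1) = f (w i) := by
    have h := Function.iterate_mod_minimalPeriod_eq (f := f) (x := v) (n := (i : ℕ) + 1)
    rw [hn, Function.iterate_succ_apply'] at h
    rw [← h]
    simp [w, Fin.val_add]
  refine ⟨n, fun i => w i, fun i => g (w i), fun i => t (w i), fun i => s (g (w i)),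
    Subtype.val_injective.comp hw, fun i j hij => ?_, fun i => ?_⟩
  · have h : w (i + 1) = w (j + 1) := by
      rw [hstep, hstep]
      exact congrArg k (Subtype.ext hij)
    exact add_right_cancel (hw h)
  · exact ⟨hta _, rfl, (congrArg Subtype.val (hstep i)).symm, hsb _, ht _, hs _⟩
end

section
/- Pushing an alternating cycle preserves hyperflows: let φ be an (α,β)-hyperflow of a finite bipartite multigraph G, let n ≥ 1, let x : Fin n → X, y : Fin n → Y, and let p, q : Fin n → E be such that for every i ∈ Fin n one has a(p i) = x i, b(p i) = y i, a(q i) = x (i+1 mod n), b(q i) = y i, and such that the 2n edges p 0, …, p (n−1), q 0, …, q (n−1) are pairwise distinct. Let m be a real number with 0 ≤ m and m ≤ φ(p i) for every i. Then the function ψ : E → ℝ defined by ψ(p i) = φ(p i) − m for all i, ψ(q i) = φ(q i) + m for all i, and ψ(e) = φ(e) for every other edge e, is again an (α,β)-hyperflow of G. -/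
open Finset

/-- Summing over a fibre of `f` the point masses of weight `m` placed along a family `p` counts the
members of the family that lie in the fibre. -/
theorem sum_fiber_sum_ite_eq {ι E V : Type*} [Fintype ι] [Fintype E] [DecidableEq E]
    [DecidableEq V] (f : E → V) (p : ι → E) (m : ℝ) (v : V) :
    ∑ e ∈ univ.filter (fun e => f e = v), ∑ i, (if e = p i then m else 0) =
      ∑ i, if f (p i) = v then m else 0 := by
  rw [sum_comm]
  refine sum_congr rfl fun i _ => ?_
  rw [sum_ite_eq']
  simp

/-- Pushing an alternating cycle preserves hyperflows: if `φ` is an `(α,β)`-hyperflow, and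
`p i : x i → y i`, `q i : x (i+1 mod n) → y i` (for `i ∈ Fin n`, `n ≥ 1`) are `2n` pairwise
distinct edges forming an alternating cycle, and `0 ≤ m ≤ φ (p i)` for all `i`, then the
function `ψ` obtained from `φ` by subtracting `m` on the edges `p i`, adding `m` on the
edges `q i`, and leaving all other edges unchanged is again an `(α,β)`-hyperflow. -/
theorem push_cycle_is_hyperflow {X Y E : Type*} [Fintype X] [Fintype Y] [Fintype E]
    [DecidableEq X] [DecidableEq Y] [DecidableEq E]
    (a : E → X) (b : E → Y) (α : X → ℝ) (β : Y → ℝ) (φ : E → ℝ)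
    (hφ : IsHyperflow a b α β φ)
    (n : ℕ) (x : Fin (n + 1) → X) (y : Fin (n + 1) → Y) (p q : Fin (n + 1) → E)
    (hp : ∀ i, a (p i) = x i ∧ b (p i) = y i)
    (hq : ∀ i, a (q i) = x (i + 1) ∧ b (q i) = y i)
    (hpinj : Function.Injective p) (hqinj : Function.Injective q)
    (hpq : ∀ i j, p i ≠ q j)
    (m : ℝ) (hm0 : 0 ≤ m) (hm : ∀ i, m ≤ φ (p i))
    (ψ : E → ℝ)
    (hψp : ∀ i, ψ (p i) = φ (p i) - m)
    (hψq : ∀ i, ψ (q i) = φ (q i) + m)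
    (hψo : ∀ e, (∀ i, e ≠ p i) → (∀ i, e ≠ q i) → ψ e = φ e) :
    IsHyperflow a b α β ψ := by
  have hψ : ∀ e, ψ e =
      φ e + ∑ i, (if e = q i then m else 0) - ∑ i, (if e = p i then m else 0) := by
    intro e
    by_cases hep : ∃ i, e = p i
    · obtain ⟨i, rfl⟩ := hep
      simp [hψp, hpq, hpinj.eq_iff]
    · by_cases heq : ∃ i, e = q i
      · obtain ⟨i, rfl⟩ := heq
        simp [hψq, fun j => (hpq j i).symm, hqinj.eq_iff]
      · push Not at hep heq
        simp [hψo e hep heq, hep, heq]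
  refine ⟨fun e => ?_, fun v => ?_, fun v => ?_⟩
  · by_cases hep : ∃ i, e = p i
    · obtain ⟨i, rfl⟩ := hep
      rw [hψp]
      exact sub_nonneg.2 (hm i)
    · push Not at hep
      have hq_nonneg : 0 ≤ ∑ i, (if e = q i then m else 0) :=
        sum_nonneg fun i _ => by split_ifs <;> simp [hm0]
      rw [hψ]
      simpa [hep] using add_nonneg (hφ.1 e) hq_nonneg
  · have hshift : ∑ i, (if x (i + 1) = v then m else 0) = ∑ i, if x i = v then m else 0 :=
      Equiv.sum_comp (Equiv.addRight (1 : Fin (n + 1))) fun i => if x i = v then m else 0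
    simp only [hψ, sum_sub_distrib, sum_add_distrib, sum_fiber_sum_ite_eq, hφ.2.1 v,
      (hp _).1, (hq _).1, hshift, add_sub_cancel_right]
  · simp only [hψ, sum_sub_distrib, sum_add_distrib, sum_fiber_sum_ite_eq, hφ.2.2 v,
      (hp _).2, (hq _).2, add_sub_cancel_right]
end

section
/- Let G be a finite tree (a connected acyclic simple graph on a finite vertex set), let w be a real-valued weight function on the edges of G, and let k be a real number. If for every vertex v the sum of the weights of the edges of G incident to v is an integer multiple of k, then the weight of every edge of G is an integer multiple of k. -/
open Finset

open SimpleGraph in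
/-- In a finite acyclic graph whose vertex sums of edge weights all lie in a subgroup `S`,
the weight of any edge extending a path lies in `S`. -/
theorem SimpleGraph.IsAcyclic.weight_mem_of_isPath_concat {V A : Type*} [Fintype V]
    [AddCommGroup A] {G : SimpleGraph V} [DecidableRel G.Adj] (hG : G.IsAcyclic)
    (S : AddSubgroup A) (w : Sym2 V → A)
    (hS : ∀ v, ∑ u ∈ G.neighborFinset v, w s(v, u) ∈ S) {a v u : V} (p : G.Walk a v)
    (h : G.Adj v u) (hp : (p.concat h).IsPath) : w s(v, u) ∈ S := by
  classical
  have hv : v ∈ G.neighborFinset u := by simpa using h.symm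
  have hsum := hS u
  rw [← Finset.add_sum_erase _ _ hv, Sym2.eq_swap] at hsum
  refine (S.add_mem_cancel_right (S.sum_mem fun x hx => ?_)).mp hsum
  obtain ⟨hxv, hx⟩ := Finset.mem_erase.mp hx
  have hux : G.Adj u x := by simpa using hx
  have hq : ((p.concat h).concat hux).IsPath := by
    refine hp.concat (fun hmem => hxv ?_) hux
    simpa using hG.eq_penultimate_of_adj_end hp hux hmem
  exact hG.weight_mem_of_isPath_concat S w hS (p.concat h) hux hq
termination_by Fintype.card V - p.length
decreasing_by
  have := hp.length_lt
  simp only [Walk.length_concat] at this ⊢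
  omega

/-- Let `G` be a finite tree with real edge weights `w` and let `k` be a real number.
If for every vertex `v` the sum of the weights of the edges incident to `v` is an integer
multiple of `k`, then the weight of every edge of `G` is an integer multiple of `k`. -/
theorem tree_edge_weights_multiple {V : Type*} [Fintype V] [DecidableEq V]
    (G : SimpleGraph V) [DecidableRel G.Adj] (hG : G.IsTree)
    (w : Sym2 V → ℝ) (k : ℝ)
    (h : ∀ v : V, ∃ m : ℤ, ∑ u ∈ G.neighborFinset v, w s(v, u) = m * k) :
    ∀ e ∈ G.edgeSet, ∃ m : ℤ, w e = m * k := by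
  intro e
  induction e with | _ v u
  intro he
  have hS : ∀ x, ∑ y ∈ G.neighborFinset x, w s(x, y) ∈ AddSubgroup.zmultiples k := fun x => by
    obtain ⟨m, hm⟩ := h x
    exact AddSubgroup.mem_zmultiples_iff.mpr ⟨m, by rw [hm, zsmul_eq_mul]⟩
  have huv : G.Adj v u := he
  obtain ⟨m, hm⟩ := AddSubgroup.mem_zmultiples_iff.mp
    (hG.isAcyclic.weight_mem_of_isPath_concat _ w hS .nil huv ((SimpleGraph.Walk.concat_isPath_iff huv).mpr (by simpa using huv.ne.symm)))
  exact ⟨m, by rw [← hm, zsmul_eq_mul]⟩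
end

section
/- In a cyclic word over the alphabet {a, ā}, each position carrying the letter a is cw-matching with at most one position carrying the letter ā, and each position carrying the letter ā is cw-matching with at most one position carrying the letter a. -/
/-- A list over `{a, ā}` (with `a` = `true` and `ā` = `false`) is a parenthesis word if it
has as many letters `a` as letters `ā`, and every prefix has at least as many letters `a`
as letters `ā`. -/
def IsParen (u : List Bool) : Prop :=
  u.count true = u.count false ∧
  ∀ n : ℕ, (u.take n).count false ≤ (u.take n).count true

/-- For positions `i`, `j` in the cyclic word `w`, `i` (carrying `a`) and `j` (carrying `ā`)
are cw-matching if the cyclic factor of `w` starting just after position `i` and ending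
just before position `j` — the first `(j − i − 1) mod L` letters of the rotation of `w`
starting at position `i + 1` — is a (possibly empty) parenthesis word. -/
def CwMatch (w : List Bool) (i j : Fin w.length) : Prop :=
  IsParen ((w.rotate ((i.val + 1) % w.length)).take
    ((j.val + w.length - (i.val + 1)) % w.length))

theorem not_isParen_append_false {u v : List Bool} (hu : IsParen u) :
    ¬ IsParen (u ++ false :: v) := by
  intro h
  have hp := h.2 (u.length + 1)
  simp [List.take_append, List.take_of_length_le, hu.1] at hp

theorem not_isParen_append_true {u v : List Bool} (hv : IsParen v) :
    ¬ IsParen (u ++ true :: v) := by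
  intro h
  have hc := h.1
  have hp := h.2 u.length
  have hb := hv.1
  simp at hc hp
  omega

theorem List.take_add_rotate {α : Type*} (w : List α) {s m n : ℕ} (h : m + n ≤ w.length) :
    (w.rotate s).take (m + n) = (w.rotate s).take m ++ (w.rotate (s + m)).take n := by
  rw [List.take_add, ← List.rotate_rotate,
    List.rotate_eq_drop_append_take (l := w.rotate s) (n := m) (by rw [List.length_rotate]; omega),
    List.take_append_of_le_length (by simp; omega)]

theorem List.take_succ_rotate {α : Type*} (w : List α) {s n : ℕ} (i : Fin w.length)
    (hs : s % w.length = i) (h : n + 1 ≤ w.length) :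
    (w.rotate s).take (n + 1) = w.get i :: (w.rotate (i + 1)).take n := by
  have h₁ : (w.rotate i).take 1 = [w.get i] := by
    rw [List.rotate_eq_drop_append_take i.2.le, List.drop_eq_getElem_cons i.2]
    rfl
  rw [← List.rotate_mod w s, hs, Nat.add_comm n 1, List.take_add_rotate w (by omega), h₁,
    List.singleton_append]

/-- The cw-matching relation in terms of the length of the factor between the two positions. -/
theorem CwMatch.exists_length {w : List Bool} {i j : Fin w.length} (h : CwMatch w i j) :
    ∃ m < w.length, (i.val + 1 + m = j ∨ i.val + 1 + m = j + w.length) ∧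
      IsParen ((w.rotate (i + 1)).take m) := by
  refine ⟨_, Nat.mod_lt _ i.pos, ?_, by rwa [CwMatch, List.rotate_mod] at h⟩
  have hi := i.2
  have hj := j.2
  rcases lt_or_ge i.val j.val with hij | hij
  · rw [show j.val + w.length - (i.val + 1) = j - (i + 1) + w.length by omega,
      Nat.add_mod_right, Nat.mod_eq_of_lt (by omega)]
    omega
  · rw [Nat.mod_eq_of_lt (by omega)]
    omega

theorem mod_eq_of_eq_or_eq_add {a b n : ℕ} (hb : b < n) (h : a = b ∨ a = b + n) :
    a % n = b := by
  rcases h with rfl | rfl <;> simp [Nat.mod_eq_of_lt hb]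

/-- In a cyclic word over `{a, ā}`, each position carrying `a` is cw-matching with at most
one position carrying `ā`, and each position carrying `ā` is cw-matching with at most one
position carrying `a`. -/
theorem cwMatch_unique (w : List Bool) (hw : w ≠ []) :
    (∀ i j j' : Fin w.length, w.get i = true → w.get j = false → w.get j' = false →
      CwMatch w i j → CwMatch w i j' → j = j') ∧
    (∀ j i i' : Fin w.length, w.get j = false → w.get i = true → w.get i' = true →
      CwMatch w i j → CwMatch w i' j → i = i') := by
  constructor
  · intro i j j' _ hj hj' h h'
    obtain ⟨m, hm, e, p⟩ := h.exists_length
    obtain ⟨m', hm', e', p'⟩ := h'.exists_length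
    have key : ∀ (j : Fin w.length) (m m' : ℕ), w.get j = false → m' < w.length →
        (i.val + 1 + m = j ∨ i.val + 1 + m = j + w.length) →
        IsParen ((w.rotate (i + 1)).take m) → IsParen ((w.rotate (i + 1)).take m') →
        ¬ m < m' := by
      intro j m m' hj hm' e p p' hlt
      obtain ⟨k, rfl⟩ : ∃ k, m' = m + (k + 1) := ⟨m' - m - 1, by omega⟩
      rw [List.take_add_rotate w hm'.le,
        List.take_succ_rotate w j (mod_eq_of_eq_or_eq_add j.2 e) (by omega), hj] at p'
      exact not_isParen_append_false p p'
    have h₁ := key j m m' hj hm' e p p'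
    have h₂ := key j' m' m hj' hm e' p' p
    ext
    omega
  · intro j i i' _ hi hi' h h'
    obtain ⟨m, hm, e, p⟩ := h.exists_length
    obtain ⟨m', hm', e', p'⟩ := h'.exists_length
    have key : ∀ (i i' : Fin w.length) (m m' : ℕ), w.get i = true → m' < w.length →
        (i.val + 1 + m = j ∨ i.val + 1 + m = j + w.length) →
        (i'.val + 1 + m' = j ∨ i'.val + 1 + m' = j + w.length) →
        IsParen ((w.rotate (i + 1)).take m) → IsParen ((w.rotate (i' + 1)).take m') →
        ¬ m < m' := by
      intro i i' m m' hi hm' e e' p p' hlt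
      obtain ⟨k, rfl⟩ : ∃ k, m' = k + (m + 1) := ⟨m' - m - 1, by omega⟩
      rw [List.take_add_rotate w hm'.le,
        List.take_succ_rotate w i (mod_eq_of_eq_or_eq_add i.2 (by omega)) (by omega), hi] at p'
      exact not_isParen_append_true p p'
    have h₁ := key i i' m m' hi hm' e e' p p'
    have h₂ := key i' i m' m hi' hm e' e p' p
    ext
    omega
end

section
/- Let w be a nonempty cyclic word over {a, ā} containing n_a occurrences of a and n_ā occurrences of ā, and suppose n_a ≥ n_ā. Then every position of w carrying the letter ā has a cw-matching position carrying the letter a, and the number of positions carrying the letter a that are cw-matching with no position carrying ā equals n_a − n_ā. -/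
/-- The height of the `n`-th prefix of the infinite periodic word `www…`: the number of its
letters `a` minus the number of its letters `ā`. -/
def cyclicHeight (w : List Bool) (n : ℕ) : ℤ :=
  ∑ k ∈ Finset.range n, if w.getD (k % w.length) false then 1 else -1

theorem cyclicHeight_succ (w : List Bool) (n : ℕ) :
    cyclicHeight w (n + 1) =
      cyclicHeight w n + if w.getD (n % w.length) false then 1 else -1 :=
  Finset.sum_range_succ _ _

theorem count_take_rotate (w : List Bool) (r n : ℕ) (hn : n ≤ w.length) :
    (((w.rotate r).take n).count true : ℤ) - ((w.rotate r).take n).count false =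
      cyclicHeight w (r + n) - cyclicHeight w r := by
  induction n with
  | zero => simp
  | succ n ih =>
    have hlt : n < (w.rotate r).length := by simpa using hn
    have hmod : (r + n) % w.length < w.length := Nat.mod_lt _ (by omega)
    rw [List.take_succ_eq_append_getElem hlt, List.getElem_rotate, ← add_assoc,
      cyclicHeight_succ, List.getD_eq_getElem _ _ hmod]
    have ih := ih (by omega)
    simp only [List.count_append, add_comm n r]
    cases w[(r + n) % w.length] <;> simp <;> linarith

theorem cyclicHeight_add_length (w : List Bool) (n : ℕ) :
    cyclicHeight w (n + w.length) =
      cyclicHeight w n + ((w.count true : ℤ) - w.count false) := by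
  have h := count_take_rotate w n w.length le_rfl
  rw [List.take_of_length_le (by simp), (List.rotate_perm w n).count_eq,
    (List.rotate_perm w n).count_eq] at h
  linarith

theorem isParen_take_rotate_iff (w : List Bool) (r m : ℕ) (hm : m ≤ w.length) :
    IsParen ((w.rotate r).take m) ↔
      cyclicHeight w (r + m) = cyclicHeight w r ∧
        ∀ n ≤ m, cyclicHeight w r ≤ cyclicHeight w (r + n) := by
  unfold IsParen
  refine and_congr ?_ ⟨fun h n hn => ?_, fun h n => ?_⟩
  · have := count_take_rotate w r m hm
    omega
  · have h1 := h n
    rw [List.take_take, min_eq_left hn] at h1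
    have := count_take_rotate w r n (hn.trans hm)
    omega
  · rw [List.take_take]
    have := count_take_rotate w r (min n m) ((min_le_right _ _).trans hm)
    have := h (min n m) (min_le_right _ _)
    omega

theorem cwMatch_iff_cyclicHeight (w : List Bool) (i j : Fin w.length) {p q : ℕ}
    (hp : p % w.length = i) (hq : q % w.length = j) (hpq : p < q) (hqp : q ≤ p + w.length) :
    CwMatch w i j ↔ cyclicHeight w q = cyclicHeight w (p + 1) ∧
      ∀ k, p < k → k ≤ q → cyclicHeight w (p + 1) ≤ cyclicHeight w k := by
  have hlen : (j.val + w.length - (i.val + 1)) % w.length = q - (p + 1) := by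
    have hi := i.isLt
    have hlt : q - (p + 1) < w.length := by omega
    rw [← Nat.mod_eq_of_lt hlt]
    change _ ≡ _ [MOD w.length]
    apply Nat.ModEq.add_right_cancel' (i.val + 1)
    rw [Nat.sub_add_cancel (by omega)]
    have h1 : p ≡ i [MOD w.length] := by rw [← hp]; exact (Nat.mod_modEq _ _).symm
    have h2 : q ≡ j [MOD w.length] := by rw [← hq]; exact (Nat.mod_modEq _ _).symm
    have h3 : q - (p + 1) + (i.val + 1) ≡ q - (p + 1) + (p + 1) [MOD w.length] :=
      ((h1.symm.add_right 1).add_left _)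
    rw [Nat.sub_add_cancel (by omega)] at h3
    refine Nat.ModEq.trans ?_ (h3.trans h2).symm
    simp [Nat.ModEq]
  have hrot : w.rotate ((i.val + 1) % w.length) = w.rotate (p + 1) := by
    rw [← hp, Nat.mod_add_mod, List.rotate_mod]
  rw [CwMatch, hlen, hrot, isParen_take_rotate_iff _ _ _ (by omega),
    Nat.add_sub_cancel' (by omega : p + 1 ≤ q)]
  refine and_congr_right fun _ => ⟨fun h k h1 h2 => ?_, fun h n hn => h _ (by omega) (by omega)⟩
  simpa [Nat.add_sub_cancel' (by omega : p + 1 ≤ k)] using h (k - (p + 1)) (by omega)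

theorem cyclicHeight_succ_of_get (w : List Bool) (i : Fin w.length) {p : ℕ}
    (hp : p % w.length = i) :
    cyclicHeight w (p + 1) = cyclicHeight w p + if w.get i then 1 else -1 := by
  rw [cyclicHeight_succ, hp, List.getD_eq_getElem _ _ i.isLt, List.get_eq_getElem]

theorem exists_lt_mod_eq {L : ℕ} (i : Fin L) (n : ℕ) :
    ∃ p, p % L = i ∧ n ≤ p ∧ p < n + L := by
  have hL : 0 < L := i.pos
  obtain hlt | hle := lt_or_ge i.val (n % L)
  · refine ⟨i + L * (n / L + 1), by simp [Nat.mod_eq_of_lt i.isLt], ?_, ?_⟩ <;>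
    · have := Nat.div_add_mod n L
      have := Nat.mod_lt n hL
      have := i.isLt
      rw [mul_add]
      omega
  · refine ⟨i + L * (n / L), by simp [Nat.mod_eq_of_lt i.isLt], ?_, ?_⟩ <;>
    · have := Nat.div_add_mod n L
      have := i.isLt
      omega

theorem CwMatch.right_unique {w : List Bool} {i j j' : Fin w.length}
    (hj : w.get j = false) (hj' : w.get j' = false)
    (h : CwMatch w i j) (h' : CwMatch w i j') : j = j' := by
  have hi : i.val % w.length = i := Nat.mod_eq_of_lt i.isLt
  obtain ⟨q, hq, hq1, hq2⟩ := exists_lt_mod_eq j (i + 1)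
  obtain ⟨q', hq', hq1', hq2'⟩ := exists_lt_mod_eq j' (i + 1)
  rw [cwMatch_iff_cyclicHeight w i j hi hq (by omega) (by omega)] at h
  rw [cwMatch_iff_cyclicHeight w i j' hi hq' (by omega) (by omega)] at h'
  have s := cyclicHeight_succ_of_get w j hq
  have s' := cyclicHeight_succ_of_get w j' hq'
  simp only [hj, hj', Bool.false_eq_true, if_false] at s s'
  obtain hlt | rfl | hlt := lt_trichotomy q q'
  · have := h'.2 (q + 1) (by omega) (by omega)
    omega
  · exact Fin.ext (hq.symm.trans hq')
  · have := h.2 (q' + 1) (by omega) (by omega)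
    omega

theorem CwMatch.left_unique {w : List Bool} {i i' j : Fin w.length}
    (hi : w.get i = true) (hi' : w.get i' = true)
    (h : CwMatch w i j) (h' : CwMatch w i' j) : i = i' := by
  have hj : (j.val + w.length) % w.length = j := by simp [Nat.mod_eq_of_lt j.isLt]
  obtain ⟨p, hp, hp1, hp2⟩ := exists_lt_mod_eq i j
  obtain ⟨p', hp', hp1', hp2'⟩ := exists_lt_mod_eq i' j
  rw [cwMatch_iff_cyclicHeight w i j hp hj (by omega) (by omega)] at h
  rw [cwMatch_iff_cyclicHeight w i' j hp' hj (by omega) (by omega)] at h'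
  have s := cyclicHeight_succ_of_get w i hp
  have s' := cyclicHeight_succ_of_get w i' hp'
  simp only [hi, hi', if_true] at s s'
  obtain hlt | rfl | hlt := lt_trichotomy p p'
  · have := h.2 p' (by omega) (by omega)
    omega
  · exact Fin.ext (hp.symm.trans hp')
  · have := h'.2 p (by omega) (by omega)
    omega

theorem exists_cwMatch_of_get_eq_false (w : List Bool) (h : w.count false ≤ w.count true)
    (j : Fin w.length) (hj : w.get j = false) :
    ∃ i : Fin w.length, w.get i = true ∧ CwMatch w i j := by
  set q := j.val + w.length with hqdef
  have hq : q % w.length = j := by simp [hqdef, Nat.mod_eq_of_lt j.isLt]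
  have hL : 0 < w.length := j.pos
  have hs := cyclicHeight_succ_of_get w j hq
  have hper := cyclicHeight_add_length w (j + 1)
  rw [show j.val + 1 + w.length = q + 1 by omega] at hper
  simp only [hj, Bool.false_eq_true, if_false] at hs
  let P : ℕ → Prop := fun p => cyclicHeight w p ≤ cyclicHeight w (q + 1)
  have hP : P (j + 1) := by simp only [P]; omega
  set p := Nat.findGreatest P q with hpdef
  have hpP : P p := Nat.findGreatest_spec (by omega : j.val + 1 ≤ q) hP
  have hjp : j.val + 1 ≤ p := Nat.le_findGreatest (by omega) hP
  have hpq : p ≤ q := Nat.findGreatest_le q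
  have hgt : ∀ k, p < k → k ≤ q → cyclicHeight w (q + 1) < cyclicHeight w k :=
    fun k h1 h2 => not_le.1 (Nat.findGreatest_is_greatest h1 h2)
  simp only [P] at hpP
  have hne : p ≠ q := by intro heq; rw [heq] at hpP; omega
  let i : Fin w.length := ⟨p % w.length, Nat.mod_lt _ hL⟩
  have hsp := cyclicHeight_succ_of_get w i (p := p) rfl
  have hp1 := hgt (p + 1) (by omega) (by omega)
  have hi : w.get i = true := by
    by_contra hc
    rw [if_neg hc] at hsp
    omega
  rw [if_pos hi] at hsp
  refine ⟨i, hi, (cwMatch_iff_cyclicHeight w i j (p := p) rfl hq (by omega) (by omega)).2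
    ⟨by omega, fun k h1 h2 => ?_⟩⟩
  have := hgt k h1 h2
  omega

theorem List.card_filter_get_eq {α : Type*} [DecidableEq α] (l : List α) (a : α) :
    (Finset.univ.filter fun i : Fin l.length => l.get i = a).card = l.count a := by
  induction l with
  | nil => simp
  | cons b l ih =>
    have := Fin.card_filter_univ_succ (fun i : Fin (l.length + 1) => (b :: l).get i = a)
    simp only [List.length_cons]
    rw [this, List.count_cons, ← ih]
    by_cases hb : b = a <;> simp [hb]

/-- If a nonempty cyclic word `w` over `{a, ā}` has `n_a` letters `a` and `n_ā` letters `ā`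
with `n_a ≥ n_ā`, then every position carrying `ā` has a cw-matching position carrying `a`,
and the number of positions carrying `a` with no cw-matching position carrying `ā` is
`n_a − n_ā`. -/
theorem cwMatch_count (w : List Bool) (hw : w ≠ []) (h : w.count false ≤ w.count true) :
    (∀ j : Fin w.length, w.get j = false →
      ∃ i : Fin w.length, w.get i = true ∧ CwMatch w i j) ∧
    Nat.card {i : Fin w.length //
        w.get i = true ∧ ∀ j : Fin w.length, w.get j = false → ¬ CwMatch w i j}
      = w.count true - w.count false := by
  classical
  have hex := exists_cwMatch_of_get_eq_false w h
  refine ⟨hex, ?_⟩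
  choose f hf hfm using hex
  have hcard : (Finset.univ.filter fun j : Fin w.length => w.get j = false).card =
      ((Finset.univ.filter fun i : Fin w.length => w.get i = true).filter
        fun i => ∃ j, w.get j = false ∧ CwMatch w i j).card := by
    refine Finset.card_bij (fun j hj => f j (Finset.mem_filter.1 hj).2) ?_ ?_ ?_
    · intro j hj
      have hj := (Finset.mem_filter.1 hj).2
      simp only [Finset.mem_filter, Finset.mem_univ, true_and]
      exact ⟨hf j hj, j, hj, hfm j hj⟩
    · intro j hj j' hj' heq
      have hj := (Finset.mem_filter.1 hj).2
      have hj' := (Finset.mem_filter.1 hj').2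
      have hm := hfm j hj
      rw [heq] at hm
      exact hm.right_unique hj hj' (hfm j' hj')
    · intro i hi
      simp only [Finset.mem_filter, Finset.mem_univ, true_and] at hi
      obtain ⟨hi, j, hj, hm⟩ := hi
      exact ⟨j, by simpa using hj, (hfm j hj).left_unique (hf j hj) hi hm⟩
  have hsum := Finset.card_filter_add_card_filter_not
    (s := Finset.univ.filter fun i : Fin w.length => w.get i = true)
    (fun i => ∃ j, w.get j = false ∧ CwMatch w i j)
  rw [← hcard, List.card_filter_get_eq, List.card_filter_get_eq, Finset.filter_filter] at hsum
  rw [Nat.card_eq_fintype_card, Fintype.card_subtype]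
  simp only [not_exists, not_and] at hsum
  omega
end
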